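/- arXiv:2211.02827 — 4 statements merged into one kernel-verified Lean document; each statement's English description precedes it below -/
import Mathlib

section
/- For every x ∈ ∂D, g(x) ≥ (3/5)·log 3 − log 5, and this minimum is attained: g(φ(0)) = (3/5)·log 3 − log 5, where φ(0) = (1/5, 3/5, 1/5) ∈ ∂D. That is, min over ∂D of g equals (3/5)·log 3 − log 5, attained at φ(0). -/
/-- The circle `∂𝔻` in the plane `H = {x₁ + x₂ + x₃ = 1}` in `ℝ³`. -/
def sphereD : Set (ℝ × ℝ × ℝ) :=
  {p | p.1 + p.2.1 + p.2.2 = 1 ∧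
    (p.1 - 1/3)^2 + (p.2.1 - 1/3)^2 + (p.2.2 - 1/3)^2 = 8/75}

/-- The parametrization `φ` of the circle `∂𝔻`. -/
noncomputable def φ (θ : ℝ) : ℝ × ℝ × ℝ :=
  (1/3 - (2/15) * Real.cos θ + (2 * Real.sqrt 3 / 15) * Real.sin θ,
   1/3 + (4/15) * Real.cos θ,
   1/3 - (2/15) * Real.cos θ - (2 * Real.sqrt 3 / 15) * Real.sin θ)

/-- The entropy-type function `g(x₁,x₂,x₃) = Σⱼ xⱼ log xⱼ`
(recall `Real.log 0 = 0`, so the convention `0 log 0 = 0` is automatic). -/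
noncomputable def g (p : ℝ × ℝ × ℝ) : ℝ :=
  p.1 * Real.log p.1 + p.2.1 * Real.log p.2.1 + p.2.2 * Real.log p.2.2

/-- The parabola tangent to `t log t` at `1` and meeting it again at `3` lies below it on `(0, 3]`. -/
lemma parabola_le_mul_log {t : ℝ} (ht : 0 < t) (ht3 : t ≤ 3) :
    (t - 1) + (3 * Real.log 3 - 2) / 4 * (t - 1) ^ 2 ≤ t * Real.log t := by
  set c : ℝ := (3 * Real.log 3 - 2) / 4 with hc
  have hc0 : 0 ≤ c := by
    have := Real.one_sub_inv_le_log_of_pos (show (0 : ℝ) < 3 by norm_num)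
    norm_num at this
    linarith
  have hc1 : c ≤ 1 / 2 := by
    have h1 : Real.log 3 < 4 / 3 := by
      rw [Real.log_lt_iff_lt_exp (by norm_num)]
      have h2 := Real.sum_le_exp_of_nonneg (show (0 : ℝ) ≤ 4 / 3 by norm_num) 4
      norm_num [Finset.sum_range_succ, Nat.factorial] at h2
      linarith
    linarith
  let h : ℝ → ℝ := fun s => Real.log s - (s - 1) / s - c * (s - 1) ^ 2 / s
  have hd : ∀ s, 0 < s → HasDerivAt h ((s - 1) * (1 - c * (s + 1)) / s ^ 2) s := by
    intro s hs
    have hlin := (hasDerivAt_id' s).sub_const 1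
    have := ((Real.hasDerivAt_log hs.ne').sub (hlin.div (hasDerivAt_id' s) hs.ne')).sub
      (((hlin.pow 2).const_mul c).div (hasDerivAt_id' s) hs.ne')
    refine this.congr_deriv ?_
    simp only [Pi.pow_apply]
    field_simp
    ring
  have hmvt : ∀ a b, 0 < a → a < b →
      ∃ s ∈ Set.Ioo a b, (s - 1) * (1 - c * (s + 1)) / s ^ 2 = (h b - h a) / (b - a) :=
    fun a b ha hab => exists_hasDerivAt_eq_slope h _ hab
      (fun s hs => (hd s (ha.trans_le hs.1)).continuousAt.continuousWithinAt)
      (fun s hs => hd s (ha.trans hs.1))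
  have h1 : h 1 = 0 := by simp [h]
  have h3 : h 3 = 0 := by simp only [h, hc]; ring
  have key : 0 ≤ h t := by
    rcases lt_trichotomy t 1 with hlt | rfl | hgt
    · obtain ⟨s, ⟨hs1, hs2⟩, hs⟩ := hmvt t 1 ht hlt
      have : (s - 1) * (1 - c * (s + 1)) / s ^ 2 ≤ 0 :=
        div_nonpos_of_nonpos_of_nonneg
          (mul_nonpos_of_nonpos_of_nonneg (by linarith) (by nlinarith)) (sq_nonneg s)
      rw [hs, div_le_iff₀ (by linarith), h1] at this
      linarith
    · exact h1.ge
    · by_cases hct : 0 ≤ 1 - c * (t + 1)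
      · obtain ⟨s, ⟨hs1, hs2⟩, hs⟩ := hmvt 1 t one_pos hgt
        have : 0 ≤ (s - 1) * (1 - c * (s + 1)) / s ^ 2 :=
          div_nonneg (mul_nonneg (by linarith) (by nlinarith)) (sq_nonneg s)
        rw [hs, le_div_iff₀ (by linarith), h1] at this
        linarith
      · rcases ht3.eq_or_lt with rfl | hlt
        · exact h3.ge
        obtain ⟨s, ⟨hs1, hs2⟩, hs⟩ := hmvt t 3 ht hlt
        have : (s - 1) * (1 - c * (s + 1)) / s ^ 2 ≤ 0 :=
          div_nonpos_of_nonpos_of_nonneg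
            (mul_nonpos_of_nonneg_of_nonpos (by linarith) (by nlinarith)) (sq_nonneg s)
        rw [hs, div_le_iff₀ (by linarith), h3] at this
        linarith
  have hmul := mul_nonneg ht.le key
  have heq : t * h t = t * Real.log t - (t - 1) - c * (t - 1) ^ 2 := by
    simp only [h]
    field_simp
  linarith

/-- Each coordinate of a point of the circle lies in `[1/15, 3/5]`. -/
lemma mem_Icc_of_circle {x y z : ℝ} (hsum : x + y + z = 1)
    (hsq : (x - 1/3)^2 + (y - 1/3)^2 + (z - 1/3)^2 = 8/75) :
    x ∈ Set.Icc (1/15) (3/5) := by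
  obtain rfl : z = 1 - x - y := by linarith
  have : (15 * x - 1) * (5 * x - 3) ≤ 0 := by nlinarith [sq_nonneg (x + 2 * y - 1)]
  constructor <;> nlinarith

lemma parabola_sub_le_mul_log {x : ℝ} (hx : x ∈ Set.Icc (1/15) (3/5)) :
    ((5 * x - 1) + (3 * Real.log 3 - 2) / 4 * (5 * x - 1) ^ 2) / 5 - x * Real.log 5
      ≤ x * Real.log x := by
  obtain ⟨hx1, hx2⟩ := hx
  have hx0 : 0 < x := by linarith
  have := parabola_le_mul_log (t := 5 * x) (by linarith) (by linarith)
  rw [Real.log_mul (by norm_num) hx0.ne'] at this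
  linarith

theorem stmt_2 :
    (∀ x ∈ sphereD, (3/5) * Real.log 3 - Real.log 5 ≤ g x) ∧
    φ 0 = (1/5, 3/5, 1/5) ∧ φ 0 ∈ sphereD ∧
    g (φ 0) = (3/5) * Real.log 3 - Real.log 5 := by
  have hφ : φ 0 = (1/5, 3/5, 1/5) := by
    simp only [φ, Real.cos_zero, Real.sin_zero]
    norm_num
  refine ⟨?_, hφ, ?_, ?_⟩
  · rintro ⟨x, y, z⟩ ⟨hsum, hsq⟩
    dsimp only at hsum hsq
    have hx := parabola_sub_le_mul_log (mem_Icc_of_circle hsum hsq)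
    have hy := parabola_sub_le_mul_log
      (mem_Icc_of_circle (x := y) (y := z) (z := x) (by linarith) (by linarith))
    have hz := parabola_sub_le_mul_log
      (mem_Icc_of_circle (x := z) (y := x) (z := y) (by linarith) (by linarith))
    have hlin : x * Real.log 5 + y * Real.log 5 + z * Real.log 5 = Real.log 5 := by
      rw [← add_mul, ← add_mul, hsum, one_mul]
    have hquad : (5 * x - 1) ^ 2 + (5 * y - 1) ^ 2 + (5 * z - 1) ^ 2 = 4 := by
      linear_combination 25 * hsq + (20 / 3) * hsum
    have hc : (3 * Real.log 3 - 2) / 4 * (5 * x - 1) ^ 2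
        + (3 * Real.log 3 - 2) / 4 * (5 * y - 1) ^ 2
        + (3 * Real.log 3 - 2) / 4 * (5 * z - 1) ^ 2 = 3 * Real.log 3 - 2 := by
      linear_combination (3 * Real.log 3 - 2) / 4 * hquad
    simp only [g]
    linarith
  · rw [hφ]
    constructor <;> norm_num
  · rw [hφ]
    simp only [g]
    rw [Real.log_div (by norm_num) (by norm_num), Real.log_div (by norm_num) (by norm_num),
      Real.log_one]
    ring
end

section
/- For every x ∈ ∂D, g(x) ≤ (14/15)·log 7 − log 15, and this maximum is attained: g(φ(π/3)) = (14/15)·log 7 − log 15, where φ(π/3) = (7/15, 7/15, 1/15) ∈ ∂D. That is, max over ∂D of g equals (14/15)·log 7 − log 15, attained at φ(π/3). -/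
theorem log_seven_bounds : 3 / 2 ≤ Real.log 7 ∧ Real.log 7 ≤ 3 := by
  constructor
  · have h : Real.exp 3 ≤ 7 ^ 2 := by
      have h1 : Real.exp 3 = Real.exp 1 ^ 3 := by rw [← Real.exp_nat_mul]; norm_num
      rw [h1]
      exact (pow_le_pow_left₀ (Real.exp_pos 1).le Real.exp_one_lt_d9.le 3).trans (by norm_num)
    have h2 := (Real.le_log_iff_exp_le (by norm_num)).2 h
    rw [Real.log_pow] at h2
    push_cast at h2
    linarith
  · rw [Real.log_le_iff_le_exp (by norm_num)]
    have h1 : Real.exp 3 = Real.exp 1 ^ 3 := by rw [← Real.exp_nat_mul]; norm_num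
    rw [h1]
    exact le_trans (by norm_num)
      (pow_le_pow_left₀ (by norm_num) Real.exp_one_gt_d9.le 3)

/-- The quadratic that agrees with `y * log y` at `1` and to first order at `7` lies above it
on `[1, ∞)`. -/
theorem mul_log_le_hermite {y : ℝ} (hy : 1 ≤ y) :
    y * Real.log y ≤ 7 * Real.log 7 + (Real.log 7 + 1) * (y - 7)
      + (6 - Real.log 7) / 36 * (y - 7) ^ 2 := by
  obtain ⟨hL, hU⟩ := log_seven_bounds
  obtain ⟨c, hc⟩ : ∃ c, c = (6 - Real.log 7) / 36 := ⟨_, rfl⟩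
  have hlog : Real.log 7 = 6 - 36 * c := by linarith
  have hc1 : 8 * c ≤ 1 := by linarith
  have hc2 : 1 ≤ 14 * c := by linarith
  have hc0 : 0 < c := by linarith
  obtain ⟨k, hk⟩ : ∃ k : ℝ → ℝ,
      k = fun t => Real.log t - (49 * c - 7) * t⁻¹ - (7 - 50 * c) - c * t := ⟨_, rfl⟩
  have hderiv : ∀ t, 1 ≤ t →
      HasDerivAt k ((7 - t) * (c * t - (1 - 7 * c)) / t ^ 2) t := by
    intro t ht
    have ht0 : t ≠ 0 := by positivity
    rw [hk]
    refine HasDerivAt.congr_deriv ((((Real.hasDerivAt_log ht0).sub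
      ((hasDerivAt_inv ht0).const_mul (49 * c - 7))).sub_const (7 - 50 * c)).sub
      ((hasDerivAt_id t).const_mul c)) ?_
    field_simp
    ring
  have hk1 : k 1 = 0 := by rw [hk]; norm_num; ring
  have hk7 : k 7 = 0 := by simp only [hk, hlog]; ring
  have hcont : ∀ a b, 1 ≤ a → ContinuousOn k (Set.Icc a b) := fun a b ha t ht =>
    (hderiv t (ha.trans ht.1)).continuousAt.continuousWithinAt
  have hky : k y ≤ 0 := by
    rcases le_total y 7 with h7 | h7
    · rcases le_total (c * y) (1 - 7 * c) with hr | hr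
      · rw [← hk1]
        refine antitoneOn_of_hasDerivWithinAt_nonpos (convex_Icc 1 y) (hcont 1 y le_rfl)
          (fun t ht => (hderiv t ?_).hasDerivWithinAt) (fun t ht => ?_)
          (Set.left_mem_Icc.2 hy) (Set.right_mem_Icc.2 hy) hy
        · exact (interior_subset ht).1
        · have ht := interior_subset ht
          have : c * t ≤ c * y := mul_le_mul_of_nonneg_left ht.2 hc0.le
          exact div_nonpos_of_nonpos_of_nonneg (mul_nonpos_of_nonneg_of_nonpos
            (by linarith [ht.2]) (by linarith)) (sq_nonneg t)
      · rw [← hk7]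
        refine monotoneOn_of_hasDerivWithinAt_nonneg (convex_Icc y 7) (hcont y 7 hy)
          (fun t ht => (hderiv t ?_).hasDerivWithinAt) (fun t ht => ?_)
          (Set.left_mem_Icc.2 h7) (Set.right_mem_Icc.2 h7) h7
        · exact hy.trans (interior_subset ht).1
        · have ht := interior_subset ht
          have : c * y ≤ c * t := mul_le_mul_of_nonneg_left ht.1 hc0.le
          exact div_nonneg (mul_nonneg (by linarith [ht.2]) (by linarith)) (sq_nonneg t)
    · rw [← hk7]
      refine antitoneOn_of_hasDerivWithinAt_nonpos (convex_Icc 7 y) (hcont 7 y (by norm_num))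
        (fun t ht => (hderiv t ?_).hasDerivWithinAt) (fun t ht => ?_)
        (Set.left_mem_Icc.2 h7) (Set.right_mem_Icc.2 h7) h7
      · linarith [(interior_subset ht).1]
      · have ht := interior_subset ht
        have : c * 7 ≤ c * t := mul_le_mul_of_nonneg_left ht.1 hc0.le
        exact div_nonpos_of_nonpos_of_nonneg (mul_nonpos_of_nonpos_of_nonneg
          (by linarith [ht.1]) (by linarith)) (sq_nonneg t)
  have hy0 : 0 < y := by linarith
  have hmul : y * k y ≤ 0 := mul_nonpos_of_nonneg_of_nonpos hy0.le hky
  have hexp : y * k y = y * Real.log y - (49 * c - 7) - (7 - 50 * c) * y - c * y ^ 2 := by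
    rw [hk]
    field_simp
  rw [← hc, hlog]
  linarith

theorem mul_log_eq_scaled {x : ℝ} (hx : 0 < x) :
    x * Real.log x = (15 * x * Real.log (15 * x)) / 15 - x * Real.log 15 := by
  rw [Real.log_mul (by norm_num) hx.ne']
  ring

theorem g_le_of_mem_sphereD {p : ℝ × ℝ × ℝ} (hp : p ∈ sphereD) :
    g p ≤ (14/15) * Real.log 7 - Real.log 15 := by
  obtain ⟨x, y, z⟩ := p
  obtain ⟨hs, hq⟩ := hp
  simp only at hs hq
  have lower : ∀ a b c : ℝ, a + b + c = 1 →
      (a - 1/3)^2 + (b - 1/3)^2 + (c - 1/3)^2 = 8/75 → 1 ≤ 15 * a := by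
    intro a b c h1 h2
    obtain rfl : c = 1 - a - b := by linarith
    have : (a - 1/3)^2 ≤ (4/15)^2 := by nlinarith [sq_nonneg (a + 2 * b - 1)]
    linarith [(abs_le_of_sq_le_sq' this (by norm_num)).1]
  have hx := lower x y z hs hq
  have hy := lower y x z (by linarith) (by linarith)
  have hz := lower z x y (by linarith) (by linarith)
  have bx := mul_log_le_hermite hx
  have bY := mul_log_le_hermite hy
  have bz := mul_log_le_hermite hz
  simp only [g]
  rw [mul_log_eq_scaled (x := x) (by linarith), mul_log_eq_scaled (x := y) (by linarith),
    mul_log_eq_scaled (x := z) (by linarith)]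
  have hlin : x * Real.log 15 + y * Real.log 15 + z * Real.log 15 = Real.log 15 := by
    rw [← add_mul, ← add_mul, hs, one_mul]
  have hsq : (15 * x - 7) ^ 2 + (15 * y - 7) ^ 2 + (15 * z - 7) ^ 2 = 36 := by
    linear_combination 225 * hq - 60 * hs
  have hlin7 : (Real.log 7 + 1) * (15 * x - 7) + (Real.log 7 + 1) * (15 * y - 7)
      + (Real.log 7 + 1) * (15 * z - 7) = -6 * (Real.log 7 + 1) := by
    linear_combination 15 * (Real.log 7 + 1) * hs
  have hsq7 : (6 - Real.log 7) / 36 * (15 * x - 7) ^ 2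
      + (6 - Real.log 7) / 36 * (15 * y - 7) ^ 2
      + (6 - Real.log 7) / 36 * (15 * z - 7) ^ 2 = 6 - Real.log 7 := by
    linear_combination (6 - Real.log 7) / 36 * hsq
  linarith

theorem φ_pi_div_three : φ (Real.pi/3) = (7/15, 7/15, 1/15) := by
  have h3 : Real.sqrt 3 * Real.sqrt 3 = 3 := Real.mul_self_sqrt (by norm_num)
  simp only [φ, Real.cos_pi_div_three, Real.sin_pi_div_three, Prod.mk.injEq]
  exact ⟨by linarith, by norm_num, by linarith⟩

theorem stmt_3 :
    (∀ x ∈ sphereD, g x ≤ (14/15) * Real.log 7 - Real.log 15) ∧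
    φ (Real.pi/3) = (7/15, 7/15, 1/15) ∧ φ (Real.pi/3) ∈ sphereD ∧
    g (φ (Real.pi/3)) = (14/15) * Real.log 7 - Real.log 15 := by
  refine ⟨fun x hx => g_le_of_mem_sphereD hx, φ_pi_div_three, ?_, ?_⟩
  · rw [φ_pi_div_three]
    constructor <;> norm_num
  · rw [φ_pi_div_three]
    simp only [g]
    rw [Real.log_div (by norm_num) (by norm_num), Real.log_div (by norm_num) (by norm_num),
      Real.log_one]
    ring
end

section
/- The function θ ↦ g(φ(θ)) is monotone nondecreasing on the interval [0, π/3]. -/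
/-- Concavity of the logarithm, in three-point form without denominators. -/
theorem log_three_point_nonneg {a b c : ℝ} (ha : 0 < a) (hab : a ≤ b) (hbc : b ≤ c) :
    0 ≤ (c - a) * Real.log b + (a - b) * Real.log c + (b - c) * Real.log a := by
  have hb : 0 < b := ha.trans_le hab
  have hc : 0 < c := hb.trans_le hbc
  have h₁ := Real.log_le_sub_one_of_pos (div_pos ha hb)
  have h₂ := Real.log_le_sub_one_of_pos (div_pos hc hb)
  rw [Real.log_div ha.ne' hb.ne'] at h₁
  rw [Real.log_div hc.ne' hb.ne'] at h₂
  have h₃ := mul_le_mul_of_nonneg_left h₁ (sub_nonneg.2 hbc)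
  have h₄ := mul_le_mul_of_nonneg_left h₂ (sub_nonneg.2 hab)
  have h₅ : (c - b) * (a / b - 1) + (b - a) * (c / b - 1) = 0 := by
    field_simp
    ring
  linarith

/-- On `[0, π/3]` the coordinates of `φ θ` are positive and ordered. -/
theorem φ_pos_and_ordered {θ : ℝ} (hθ : θ ∈ Set.Icc 0 (Real.pi / 3)) :
    0 < (φ θ).2.2 ∧ (φ θ).2.2 ≤ (φ θ).1 ∧ (φ θ).1 ≤ (φ θ).2.1 := by
  obtain ⟨h0, h1⟩ := hθ
  have hpi := Real.pi_pos
  have h3 : Real.sqrt 3 ^ 2 = 3 := Real.sq_sqrt (by norm_num)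
  have h3pos : 0 < Real.sqrt 3 := Real.sqrt_pos.2 (by norm_num)
  have hsin : 0 ≤ Real.sin θ := Real.sin_nonneg_of_nonneg_of_le_pi h0 (by linarith)
  have hcos : 1 / 2 ≤ Real.cos θ := by
    rw [← Real.cos_pi_div_three]
    exact Real.cos_le_cos_of_nonneg_of_le_pi h0 (by linarith) h1
  have hsin' : Real.sin θ ≤ Real.sqrt 3 / 2 := by
    rw [← Real.sin_pi_div_three]
    exact Real.sin_le_sin_of_le_of_le_pi_div_two (by linarith) (by linarith) h1
  have hsq := Real.sin_sq_add_cos_sq θ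
  have hsum : Real.cos θ + Real.sqrt 3 * Real.sin θ ≤ 2 := by
    nlinarith [sq_nonneg (Real.cos θ - 1 / 2), sq_nonneg (Real.sin θ - Real.sqrt 3 / 2)]
  have hprod : 0 ≤ Real.sqrt 3 * Real.sin θ := by positivity
  have hprod' := mul_le_mul_of_nonneg_left hsin' h3pos.le
  simp only [φ]
  refine ⟨?_, ?_, ?_⟩ <;> nlinarith

/-- The derivative of `g ∘ φ`, multiplied by `√3`, is a three-point expression in the logarithm. -/
theorem hasDerivAt_g_φ {θ : ℝ} (h₁ : (φ θ).1 ≠ 0) (h₂ : (φ θ).2.1 ≠ 0) (h₃ : (φ θ).2.2 ≠ 0) :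
    HasDerivAt (fun θ : ℝ => g (φ θ))
      ((((φ θ).2.1 - (φ θ).2.2) * Real.log (φ θ).1 + ((φ θ).2.2 - (φ θ).1) * Real.log (φ θ).2.1
        + ((φ θ).1 - (φ θ).2.1) * Real.log (φ θ).2.2) / Real.sqrt 3) θ := by
  have h3 : Real.sqrt 3 ^ 2 = 3 := Real.sq_sqrt (by norm_num)
  have h3pos : 0 < Real.sqrt 3 := Real.sqrt_pos.2 (by norm_num)
  have hc := Real.hasDerivAt_cos θ
  have hs := Real.hasDerivAt_sin θ
  have d₁ : HasDerivAt (fun θ => (φ θ).1) (((φ θ).2.1 - (φ θ).2.2) / Real.sqrt 3) θ := by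
    refine (((hc.const_mul (2 / 15)).const_sub (1 / 3)).add
      (hs.const_mul (2 * Real.sqrt 3 / 15))).congr_deriv ?_
    simp only [φ]
    field_simp
    linear_combination (6 * Real.cos θ) * h3
  have d₂ : HasDerivAt (fun θ => (φ θ).2.1) (((φ θ).2.2 - (φ θ).1) / Real.sqrt 3) θ := by
    refine ((hc.const_mul (4 / 15)).const_add (1 / 3)).congr_deriv ?_
    simp only [φ]
    field_simp
    ring
  have d₃ : HasDerivAt (fun θ => (φ θ).2.2) (((φ θ).1 - (φ θ).2.1) / Real.sqrt 3) θ := by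
    refine (((hc.const_mul (2 / 15)).const_sub (1 / 3)).sub
      (hs.const_mul (2 * Real.sqrt 3 / 15))).congr_deriv ?_
    simp only [φ]
    field_simp
    linear_combination (-6 * Real.cos θ) * h3
  refine ((((Real.hasDerivAt_mul_log h₁).comp θ d₁).add
    ((Real.hasDerivAt_mul_log h₂).comp θ d₂)).add
    ((Real.hasDerivAt_mul_log h₃).comp θ d₃)).congr_deriv ?_
  ring

theorem stmt_5 :
    MonotoneOn (fun θ : ℝ => g (φ θ)) (Set.Icc 0 (Real.pi / 3)) := by
  have hderiv : ∀ θ ∈ Set.Icc 0 (Real.pi / 3), ∃ d, 0 ≤ d ∧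
      HasDerivAt (fun θ : ℝ => g (φ θ)) d θ := by
    intro θ hθ
    obtain ⟨h₃, h₃₁, h₁₂⟩ := φ_pos_and_ordered hθ
    have h₁ := h₃.trans_le h₃₁
    exact ⟨_, div_nonneg (log_three_point_nonneg h₃ h₃₁ h₁₂) (Real.sqrt_nonneg 3),
      hasDerivAt_g_φ h₁.ne' (h₁.trans_le h₁₂).ne' h₃.ne'⟩
  refine monotoneOn_of_deriv_nonneg (convex_Icc _ _) ?_ ?_ ?_
  · intro θ hθ
    obtain ⟨d, -, hd⟩ := hderiv θ hθ
    exact hd.continuousAt.continuousWithinAt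
  · intro θ hθ
    obtain ⟨d, -, hd⟩ := hderiv θ (interior_subset hθ)
    exact hd.differentiableAt.differentiableWithinAt
  · intro θ hθ
    obtain ⟨d, hd₀, hd⟩ := hderiv θ (interior_subset hθ)
    rwa [hd.deriv]
end

section
/- Each of the maps Ψ₁, Ψ₂, Ψ₃ maps D̄ into D̄, and each maps ∂D into ∂D. -/
/-- The closed disk `𝔻̄` in the plane `H = {x₁ + x₂ + x₃ = 1}` in `ℝ³`. -/
def closedD : Set (ℝ × ℝ × ℝ) :=
  {p | p.1 + p.2.1 + p.2.2 = 1 ∧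
    (p.1 - 1/3)^2 + (p.2.1 - 1/3)^2 + (p.2.2 - 1/3)^2 ≤ 8/75}

/-- The map `Ψ₁(x) = (1/(15x₁))·(10x₁, 4x₁+3x₂, 4x₁+3x₃) − (1/(25x₁))·(1,2,2)`. -/
noncomputable def Ψ₁ (p : ℝ × ℝ × ℝ) : ℝ × ℝ × ℝ :=
  ((10 * p.1) / (15 * p.1) - 1 / (25 * p.1),
   (4 * p.1 + 3 * p.2.1) / (15 * p.1) - 2 / (25 * p.1),
   (4 * p.1 + 3 * p.2.2) / (15 * p.1) - 2 / (25 * p.1))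

/-- The cyclic rotation `R(x₁,x₂,x₃) = (x₂,x₃,x₁)`. -/
def R (p : ℝ × ℝ × ℝ) : ℝ × ℝ × ℝ := (p.2.1, p.2.2, p.1)

/-- The inverse rotation `R⁻¹(x₁,x₂,x₃) = (x₃,x₁,x₂)`. -/
def Rinv (p : ℝ × ℝ × ℝ) : ℝ × ℝ × ℝ := (p.2.2, p.1, p.2.1)

/-- `Ψ₂ = R⁻¹ ∘ Ψ₁ ∘ R`. -/
noncomputable def Ψ₂ : ℝ × ℝ × ℝ → ℝ × ℝ × ℝ := Rinv ∘ Ψ₁ ∘ R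

/-- `Ψ₃ = R ∘ Ψ₁ ∘ R⁻¹`. -/
noncomputable def Ψ₃ : ℝ × ℝ × ℝ → ℝ × ℝ × ℝ := R ∘ Ψ₁ ∘ Rinv

/-- Every point of the closed disk has positive first coordinate. -/
lemma fst_pos_of_mem_closedD {p : ℝ × ℝ × ℝ} (hp : p ∈ closedD) : 0 < p.1 := by
  obtain ⟨x, y, z⟩ := p
  obtain ⟨hsum, hdist⟩ := hp
  dsimp only at *
  nlinarith [sq_nonneg (y - z)]

lemma sphereD_subset_closedD : sphereD ⊆ closedD := fun _ hp => ⟨hp.1, hp.2.le⟩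

lemma Ψ₁_coord_sum {p : ℝ × ℝ × ℝ} (hp : p.1 ≠ 0) (hsum : p.1 + p.2.1 + p.2.2 = 1) :
    (Ψ₁ p).1 + (Ψ₁ p).2.1 + (Ψ₁ p).2.2 = 1 := by
  obtain ⟨x, y, z⟩ := p
  obtain rfl : z = 1 - x - y := by dsimp only at hsum; linarith
  dsimp only [Ψ₁] at *
  field_simp
  ring

/-- On the plane `H`, the power of a point with respect to `∂𝔻` is scaled by `1 / (25 x₁²)`. -/
lemma Ψ₁_power {p : ℝ × ℝ × ℝ} (hp : p.1 ≠ 0) (hsum : p.1 + p.2.1 + p.2.2 = 1) :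
    ((Ψ₁ p).1 - 1/3)^2 + ((Ψ₁ p).2.1 - 1/3)^2 + ((Ψ₁ p).2.2 - 1/3)^2 - 8/75 =
      ((p.1 - 1/3)^2 + (p.2.1 - 1/3)^2 + (p.2.2 - 1/3)^2 - 8/75) / (25 * p.1^2) := by
  obtain ⟨x, y, z⟩ := p
  obtain rfl : z = 1 - x - y := by dsimp only at hsum; linarith
  dsimp only [Ψ₁] at *
  field_simp
  ring

lemma mapsTo_Ψ₁_closedD : Set.MapsTo Ψ₁ closedD closedD := by
  intro p hp
  have hx := (fst_pos_of_mem_closedD hp).ne'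
  refine ⟨Ψ₁_coord_sum hx hp.1, sub_nonpos.mp ?_⟩
  rw [Ψ₁_power hx hp.1]
  exact div_nonpos_of_nonpos_of_nonneg (sub_nonpos.mpr hp.2) (by positivity)

lemma mapsTo_Ψ₁_sphereD : Set.MapsTo Ψ₁ sphereD sphereD := by
  intro p hp
  have hx := (fst_pos_of_mem_closedD (sphereD_subset_closedD hp)).ne'
  refine ⟨Ψ₁_coord_sum hx hp.1, sub_eq_zero.mp ?_⟩
  rw [Ψ₁_power hx hp.1, sub_eq_zero.mpr hp.2, zero_div]

lemma mapsTo_R_closedD : Set.MapsTo R closedD closedD := fun p hp =>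
  ⟨by rw [← hp.1]; dsimp only [R]; ring, le_of_eq_of_le (by dsimp only [R]; ring) hp.2⟩

lemma mapsTo_Rinv_closedD : Set.MapsTo Rinv closedD closedD := fun p hp =>
  ⟨by rw [← hp.1]; dsimp only [Rinv]; ring, le_of_eq_of_le (by dsimp only [Rinv]; ring) hp.2⟩

lemma mapsTo_R_sphereD : Set.MapsTo R sphereD sphereD := fun p hp =>
  ⟨by rw [← hp.1]; dsimp only [R]; ring, by rw [← hp.2]; dsimp only [R]; ring⟩

lemma mapsTo_Rinv_sphereD : Set.MapsTo Rinv sphereD sphereD := fun p hp =>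
  ⟨by rw [← hp.1]; dsimp only [Rinv]; ring, by rw [← hp.2]; dsimp only [Rinv]; ring⟩

theorem stmt_9 :
    (Set.MapsTo Ψ₁ closedD closedD ∧ Set.MapsTo Ψ₂ closedD closedD ∧
      Set.MapsTo Ψ₃ closedD closedD) ∧
    (Set.MapsTo Ψ₁ sphereD sphereD ∧ Set.MapsTo Ψ₂ sphereD sphereD ∧
      Set.MapsTo Ψ₃ sphereD sphereD) := by
  exact ⟨⟨mapsTo_Ψ₁_closedD,
    mapsTo_Rinv_closedD.comp (mapsTo_Ψ₁_closedD.comp mapsTo_R_closedD),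
    mapsTo_R_closedD.comp (mapsTo_Ψ₁_closedD.comp mapsTo_Rinv_closedD)⟩,
    mapsTo_Ψ₁_sphereD,
    mapsTo_Rinv_sphereD.comp (mapsTo_Ψ₁_sphereD.comp mapsTo_R_sphereD),
    mapsTo_R_sphereD.comp (mapsTo_Ψ₁_sphereD.comp mapsTo_Rinv_sphereD)⟩
end
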